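/- Assume (A2), (A3) and the normalization ψ(ξ) = 1 for |ξ| = 1. With p_t^s(x) = (2π)^{-d} ∫_{ℝ^d} e^{-iξ·x} e^{-t ψ^s(ξ)} dξ (where ψ^s(ξ) = s·ψ(ψ^{-1}(1/s)ξ) and st ≥ t₀) and p_t^α(x) = (2π)^{-d} ∫_{ℝ^d} e^{-iξ·x − t|ξ|^α} dξ, one has, for all 0 < ε < T < ∞ and R > 0: lim_{s→∞} sup{ |p_t^s(x) − p_t^α(x)| : ε ≤ t ≤ T, |x| ≤ R } = 0. -/

import Mathlib

open MeasureTheory Filter Real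
open scoped RealInnerProductSpace

noncomputable section

/-- Pruitt's concentration function `K(r) = r⁻² ∫_{|z|<r} |z|² ν(|z|) dz`. -/
def K (d : ℕ) (ν : ℝ → ℝ) (r : ℝ) : ℝ :=
  (∫ z in Metric.ball (0 : EuclideanSpace ℝ (Fin d)) r, ‖z‖ ^ 2 * ν ‖z‖) / r ^ 2

/-- Pruitt's concentration function `h(r) = ∫ (|z|²/r² ∧ 1) ν(|z|) dz`. -/
def hfun (d : ℕ) (ν : ℝ → ℝ) (r : ℝ) : ℝ :=
  ∫ z : EuclideanSpace ℝ (Fin d), min (‖z‖ ^ 2 / r ^ 2) 1 * ν ‖z‖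

/-- The characteristic (Lévy–Khintchine) exponent `ψ(ξ) = ∫ (1 - cos⟪ξ,z⟫) ν(|z|) dz`. -/
def ψ (d : ℕ) (ν : ℝ → ℝ) (ξ : EuclideanSpace ℝ (Fin d)) : ℝ :=
  ∫ z : EuclideanSpace ℝ (Fin d), (1 - Real.cos ⟪ξ, z⟫) * ν ‖z‖

/-- The radial nondecreasing majorant `ψ*(r) = sup_{|z| ≤ r} ψ(z)`. -/
def ψstar (d : ℕ) (ν : ℝ → ℝ) (r : ℝ) : ℝ :=
  sSup {y : ℝ | ∃ z : EuclideanSpace ℝ (Fin d), ‖z‖ ≤ r ∧ ψ d ν z = y}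

/-- The generalized inverse `ψ⁻¹(u) = sup {r ≥ 0 : ψ*(r) = u}`. -/
def ψinv (d : ℕ) (ν : ℝ → ℝ) (u : ℝ) : ℝ :=
  sSup {r : ℝ | 0 ≤ r ∧ ψstar d ν r = u}

/-- Characteristic exponent `ψˢ(ξ) = s·ψ(ψ⁻¹(1/s)ξ)` of the rescaled process. -/
def ψs (d : ℕ) (ν : ℝ → ℝ) (s : ℝ) (ξ : EuclideanSpace ℝ (Fin d)) : ℝ :=
  s * ψ d ν (ψinv d ν (1 / s) • ξ)

/-- Lévy density `νˢ(x) = s·ψ⁻¹(1/s)^{-d}·ν(x/ψ⁻¹(1/s))` of the rescaled process. -/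
def νs (d : ℕ) (ν : ℝ → ℝ) (s : ℝ) (x : EuclideanSpace ℝ (Fin d)) : ℝ :=
  s / ψinv d ν (1 / s) ^ d * ν (‖x‖ / ψinv d ν (1 / s))

/-- `ψ^{-1,s}(u) = ψ⁻¹(u/s)/ψ⁻¹(1/s)`. -/
def ψinvs (d : ℕ) (ν : ℝ → ℝ) (s u : ℝ) : ℝ :=
  ψinv d ν (u / s) / ψinv d ν (1 / s)

/-- The stable constant `𝒜(d,α)`. -/
def Aconst (d : ℕ) (α : ℝ) : ℝ :=
  α * (2 : ℝ) ^ (α - 1) * Real.Gamma (((d : ℝ) + α) / 2) /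
    (Real.Gamma (1 - α / 2) * Real.pi ^ ((d : ℝ) / 2))

/-- Heat kernel of the rescaled process, via Fourier inversion. -/
def pts (d : ℕ) (ν : ℝ → ℝ) (s t : ℝ) (x : EuclideanSpace ℝ (Fin d)) : ℝ :=
  ((2 * Real.pi) ^ d)⁻¹ *
    ∫ ξ : EuclideanSpace ℝ (Fin d), Real.cos ⟪ξ, x⟫ * Real.exp (-(t * ψs d ν s ξ))

/-- Heat kernel of the isotropic α-stable process. -/
def ptα (d : ℕ) (α t : ℝ) (x : EuclideanSpace ℝ (Fin d)) : ℝ :=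
  ((2 * Real.pi) ^ d)⁻¹ *
    ∫ ξ : EuclideanSpace ℝ (Fin d), Real.cos ⟪ξ, x⟫ * Real.exp (-(t * ‖ξ‖ ^ α))

/-- Heat kernel of the original process, via Fourier inversion. -/
def pt (d : ℕ) (ν : ℝ → ℝ) (t : ℝ) (x : EuclideanSpace ℝ (Fin d)) : ℝ :=
  ((2 * Real.pi) ^ d)⁻¹ *
    ∫ ξ : EuclideanSpace ℝ (Fin d), Real.cos ⟪ξ, x⟫ * Real.exp (-(t * ψ d ν ξ))

/-- A positive, non-increasing radial profile whose associated measure on `ℝ^d` is a Lévy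
measure. -/
structure IsUnimodalLevy (d : ℕ) (ν : ℝ → ℝ) : Prop where
  pos : ∀ r : ℝ, 0 < r → 0 < ν r
  anti : ∀ r₁ r₂ : ℝ, 0 < r₁ → r₁ ≤ r₂ → ν r₂ ≤ ν r₁
  integrable : Integrable (fun z : EuclideanSpace ℝ (Fin d) => min (‖z‖ ^ 2) 1 * ν ‖z‖)

theorem one_sub_cos_inner_le {d : ℕ} (ξ z : EuclideanSpace ℝ (Fin d)) :
    1 - Real.cos ⟪ξ, z⟫ ≤ 2 * max (‖ξ‖ ^ 2) 1 * min (‖z‖ ^ 2) 1 := by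
  have h1 : 1 - Real.cos ⟪ξ, z⟫ ≤ ⟪ξ, z⟫ ^ 2 / 2 := by
    linarith [Real.one_sub_sq_div_two_le_cos (x := ⟪ξ, z⟫)]
  have h2 : ⟪ξ, z⟫ ^ 2 ≤ ‖ξ‖ ^ 2 * ‖z‖ ^ 2 := by
    rw [← mul_pow, ← sq_abs]
    exact pow_le_pow_left₀ (abs_nonneg _) (abs_real_inner_le_norm ξ z) 2
  have h3 := Real.neg_one_le_cos ⟪ξ, z⟫
  have h4 := le_max_left (‖ξ‖ ^ 2) 1
  have h5 := le_max_right (‖ξ‖ ^ 2) 1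
  rcases min_cases (‖z‖ ^ 2) 1 with ⟨h, _⟩ | ⟨h, _⟩ <;> rw [h]
  · nlinarith [sq_nonneg ‖z‖, sq_nonneg ‖ξ‖]
  · linarith

theorem one_sub_cos_nonneg (x : ℝ) : 0 ≤ 1 - Real.cos x := by
  linarith [Real.cos_le_one x]

theorem ae_ne_zero {d : ℕ} [NeZero d] :
    ∀ᵐ z : EuclideanSpace ℝ (Fin d), z ≠ 0 :=
  ae_iff.mpr (by simp [Set.ofPred_eq_eq_singleton])

namespace IsUnimodalLevy

variable {d : ℕ} {ν : ℝ → ℝ}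

theorem nonneg_ae [NeZero d] (hν : IsUnimodalLevy d ν) :
    ∀ᵐ z : EuclideanSpace ℝ (Fin d), 0 < ν ‖z‖ :=
  ae_ne_zero.mono fun _ hz => hν.pos _ (norm_pos_iff.mpr hz)

theorem aestronglyMeasurable [NeZero d] (hν : IsUnimodalLevy d ν) {c : ℝ} (hc : 0 < c) :
    AEStronglyMeasurable (fun w : EuclideanSpace ℝ (Fin d) => ν (c * ‖w‖)) := by
  have hm : Measurable ((Set.Ioi 0).indicator ν) := by
    refine measurable_of_Ioi fun a => ?_
    rcases lt_or_ge a 0 with ha | ha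
    · have : (Set.Ioi 0).indicator ν ⁻¹' Set.Ioi a = Set.univ := by
        refine Set.eq_univ_of_forall fun x => ?_
        exact ha.trans_le (Set.indicator_nonneg (fun y hy => (hν.pos y hy).le) x)
      rw [this]
      exact MeasurableSet.univ
    · refine Set.OrdConnected.measurableSet ⟨fun x hx y hy z hz => ?_⟩
      have hx0 : 0 < x := by
        by_contra h
        have hx' : a < (Set.Ioi 0).indicator ν x := hx
        rw [Set.indicator_of_notMem (by simpa using h)] at hx'
        linarith
      have hz0 : 0 < z := hx0.trans_le hz.1
      have hy0 : 0 < y := hz0.trans_le hz.2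
      have hy' : a < (Set.Ioi 0).indicator ν y := hy
      change a < (Set.Ioi 0).indicator ν z
      rw [Set.indicator_of_mem (Set.mem_Ioi.mpr hy0)] at hy'
      rw [Set.indicator_of_mem (Set.mem_Ioi.mpr hz0)]
      exact hy'.trans_le (hν.anti z y hz0 hz.2)
  have hm' : Measurable fun w : EuclideanSpace ℝ (Fin d) =>
      (Set.Ioi 0).indicator ν (c * ‖w‖) := hm.comp (measurable_norm.const_mul c)
  refine hm'.aestronglyMeasurable.congr ?_
  filter_upwards [ae_ne_zero] with w hw
  exact Set.indicator_of_mem (mul_pos hc (norm_pos_iff.mpr hw)) ν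

theorem aestronglyMeasurable_one [NeZero d] (hν : IsUnimodalLevy d ν) :
    AEStronglyMeasurable (fun w : EuclideanSpace ℝ (Fin d) => ν ‖w‖) := by
  simpa using hν.aestronglyMeasurable one_pos

theorem aestronglyMeasurable_cos [NeZero d] (hν : IsUnimodalLevy d ν)
    (ξ : EuclideanSpace ℝ (Fin d)) :
    AEStronglyMeasurable (fun z : EuclideanSpace ℝ (Fin d) =>
      (1 - Real.cos ⟪ξ, z⟫) * ν ‖z‖) := by
  refine AEStronglyMeasurable.mul ?_ hν.aestronglyMeasurable_one
  exact Continuous.aestronglyMeasurable (by fun_prop)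

theorem norm_one_sub_cos_mul_le (ξ : EuclideanSpace ℝ (Fin d)) {B : ℝ}
    (hB : max (‖ξ‖ ^ 2) 1 ≤ B) {z : EuclideanSpace ℝ (Fin d)} (hz : 0 < ν ‖z‖) :
    ‖(1 - Real.cos ⟪ξ, z⟫) * ν ‖z‖‖ ≤ 2 * B * (min (‖z‖ ^ 2) 1 * ν ‖z‖) := by
  rw [Real.norm_of_nonneg (mul_nonneg (one_sub_cos_nonneg _) hz.le), ← mul_assoc]
  refine mul_le_mul_of_nonneg_right ((one_sub_cos_inner_le ξ z).trans ?_) hz.le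
  gcongr

theorem integrable_one_sub_cos [NeZero d] (hν : IsUnimodalLevy d ν)
    (ξ : EuclideanSpace ℝ (Fin d)) :
    Integrable (fun z : EuclideanSpace ℝ (Fin d) => (1 - Real.cos ⟪ξ, z⟫) * ν ‖z‖) :=
  (hν.integrable.const_mul _).mono' (hν.aestronglyMeasurable_cos ξ)
    (hν.nonneg_ae.mono fun _ hz => norm_one_sub_cos_mul_le ξ le_rfl hz)

theorem continuous_ψ [NeZero d] (hν : IsUnimodalLevy d ν) : Continuous (ψ d ν) := by
  refine continuous_iff_continuousAt.mpr fun ξ₀ => ?_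
  have hc (z : EuclideanSpace ℝ (Fin d)) :
      ContinuousAt (fun ξ => (1 - Real.cos ⟪ξ, z⟫) * ν ‖z‖) ξ₀ := by fun_prop
  refine continuousAt_of_dominated
    (bound := fun z => 2 * max ((‖ξ₀‖ + 1) ^ 2) 1 * (min (‖z‖ ^ 2) 1 * ν ‖z‖))
    (Eventually.of_forall hν.aestronglyMeasurable_cos) ?_ (hν.integrable.const_mul _)
    (Eventually.of_forall fun z => hc z)
  have : ∀ᶠ ξ in nhds ξ₀, ‖ξ‖ < ‖ξ₀‖ + 1 :=
    continuous_norm.continuousAt.eventually_lt_const (by linarith)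
  filter_upwards [this] with ξ hξ
  refine hν.nonneg_ae.mono fun z hz => norm_one_sub_cos_mul_le ξ ?_ hz
  gcongr

theorem ψ_pos [NeZero d] (hν : IsUnimodalLevy d ν) {ξ : EuclideanSpace ℝ (Fin d)} (hξ : ξ ≠ 0) :
    0 < ψ d ν ξ := by
  rw [ψ, integral_pos_iff_support_of_nonneg_ae
    (hν.nonneg_ae.mono fun z hz => mul_nonneg (one_sub_cos_nonneg _) hz.le)
    (hν.integrable_one_sub_cos ξ)]
  have hopen : IsOpen {z : EuclideanSpace ℝ (Fin d) | z ≠ 0 ∧ Real.cos ⟪ξ, z⟫ < 1} :=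
    isOpen_ne.inter (isOpen_lt (f := fun z => Real.cos ⟪ξ, z⟫) (by fun_prop) continuous_const)
  have hξ' : ‖ξ‖ ≠ 0 := norm_ne_zero_iff.mpr hξ
  have hmem : (π / ‖ξ‖ ^ 2) • ξ ∈ {z : EuclideanSpace ℝ (Fin d) | z ≠ 0 ∧ Real.cos ⟪ξ, z⟫ < 1} := by
    refine ⟨smul_ne_zero (div_ne_zero pi_ne_zero (pow_ne_zero 2 hξ')) hξ, ?_⟩
    rw [real_inner_smul_right, real_inner_self_eq_norm_sq, div_mul_cancel₀ _ (pow_ne_zero 2 hξ'),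
      Real.cos_pi]
    norm_num
  refine (hopen.measure_pos volume ⟨_, hmem⟩).trans_le (measure_mono fun z hz => ?_)
  exact mul_ne_zero (by linarith [hz.2]) (hν.pos _ (norm_pos_iff.mpr hz.1)).ne'

end IsUnimodalLevy

theorem ψ_zero (d : ℕ) (ν : ℝ → ℝ) : ψ d ν 0 = 0 := by simp [ψ]

namespace IsUnimodalLevy

variable {d : ℕ} {ν : ℝ → ℝ}

theorem ψ_nonneg [NeZero d] (hν : IsUnimodalLevy d ν) (ξ : EuclideanSpace ℝ (Fin d)) :
    0 ≤ ψ d ν ξ := by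
  rcases eq_or_ne ξ 0 with rfl | h
  · rw [ψ_zero]
  · exact (hν.ψ_pos h).le

end IsUnimodalLevy

theorem ψ_eq_of_norm_eq (d : ℕ) (ν : ℝ → ℝ) {ξ ζ : EuclideanSpace ℝ (Fin d)} (h : ‖ξ‖ = ‖ζ‖) :
    ψ d ν ξ = ψ d ν ζ := by
  set ρ := Submodule.reflection (ℝ ∙ (ξ - ζ))ᗮ with hρ
  have h1 : ρ ξ = ζ := Submodule.reflection_sub h
  have h2 := (LinearIsometryEquiv.measurePreserving ρ).integral_comp
    ρ.toHomeomorph.measurableEmbedding (fun z => (1 - Real.cos ⟪ρ ξ, z⟫) * ν ‖z‖)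
  simp only [LinearIsometryEquiv.inner_map_map, LinearIsometryEquiv.norm_map] at h2
  rw [ψ, ψ, ← h1, h2]

namespace IsUnimodalLevy

variable {d : ℕ} {ν : ℝ → ℝ}

open FourierTransform in
theorem exists_pos_le_ψ_cocompact [NeZero d] (hν : IsUnimodalLevy d ν) :
    ∃ m : ℝ, 0 < m ∧ ∀ᶠ ξ in cocompact (EuclideanSpace ℝ (Fin d)), m ≤ ψ d ν ξ := by
  set A := Metric.ball (0 : EuclideanSpace ℝ (Fin d)) 1 with hA
  have hAv : 0 < volume.real A := by
    rw [measureReal_def]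
    exact ENNReal.toReal_pos (Metric.measure_ball_pos _ _ one_pos).ne' measure_ball_lt_top.ne
  have hAm : MeasurableSet A := measurableSet_ball
  have hAi (ξ : EuclideanSpace ℝ (Fin d)) : IntegrableOn (fun z => Real.cos ⟪ξ, z⟫) A := by
    refine IntegrableOn.mono_set (t := Metric.closedBall 0 1) ?_ Metric.ball_subset_closedBall
    exact ContinuousOn.integrableOn_compact (isCompact_closedBall 0 1) (by fun_prop)
  have hAc : IntegrableOn (fun _ : EuclideanSpace ℝ (Fin d) => (1 : ℝ)) A :=
    integrableOn_const measure_ball_lt_top.ne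
  have hRL := (tendsto_integral_exp_inner_smul_cocompact (V := EuclideanSpace ℝ (Fin d))
    (A.indicator fun _ => (1 : ℂ))).comp
    (Homeomorph.smulOfNeZero (2 * π)⁻¹ (by positivity)).isClosedEmbedding.tendsto_cocompact
  have hcos : Tendsto (fun ξ : EuclideanSpace ℝ (Fin d) => ∫ z in A, Real.cos ⟪ξ, z⟫)
      (cocompact (EuclideanSpace ℝ (Fin d))) (nhds 0) := by
    have h := (Complex.continuous_re.tendsto _).comp hRL
    rw [Complex.zero_re] at h
    refine h.congr fun ξ => ?_
    have hint : Integrable fun v : EuclideanSpace ℝ (Fin d) =>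
        𝐞 (-⟪v, (2 * π)⁻¹ • ξ⟫) • A.indicator (fun _ => (1 : ℂ)) v := by
      refine (Real.fourierIntegral_convergent_iff _).mpr ?_
      exact (integrable_indicator_iff hAm).mpr (integrableOn_const measure_ball_lt_top.ne)
    have h1 := Complex.reCLM.integral_comp_comm hint
    simp only [Complex.reCLM_apply] at h1
    simp only [Function.comp_apply, Homeomorph.smulOfNeZero_apply]
    rw [← h1, ← integral_indicator hAm]
    refine integral_congr_ae (Eventually.of_forall fun v => ?_)
    by_cases hv : v ∈ A
    · simp only [Set.indicator_of_mem hv, Circle.smul_def, Real.fourierChar_apply, smul_eq_mul,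
        mul_one, real_inner_smul_right, Complex.exp_ofReal_mul_I_re]
      rw [real_inner_comm, ← Real.cos_neg]
      congr 1
      field_simp
    · simp [Set.indicator_of_notMem hv]
  refine ⟨ν 1 * (volume.real A / 2), by have := hν.pos 1 one_pos; positivity, ?_⟩
  filter_upwards [hcos.eventually_lt_const (half_pos hAv)] with ξ hξ
  calc ν 1 * (volume.real A / 2)
      ≤ ν 1 * ∫ z in A, (1 - Real.cos ⟪ξ, z⟫) := by
        have := (hν.pos 1 one_pos).le
        gcongr
        rw [integral_sub hAc (hAi ξ), setIntegral_const, smul_eq_mul, mul_one]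
        linarith
    _ = ∫ z in A, (1 - Real.cos ⟪ξ, z⟫) * ν 1 := by rw [integral_mul_const, mul_comm]
    _ ≤ ∫ z in A, (1 - Real.cos ⟪ξ, z⟫) * ν ‖z‖ := by
        refine setIntegral_mono_on_ae ((hAc.sub (hAi ξ)).mul_const _)
          (hν.integrable_one_sub_cos ξ).integrableOn hAm ?_
        filter_upwards [ae_ne_zero] with z hz hzA
        refine mul_le_mul_of_nonneg_left ?_ (one_sub_cos_nonneg _)
        exact hν.anti _ _ (norm_pos_iff.mpr hz) (mem_ball_zero_iff.mp hzA).le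
    _ ≤ ψ d ν ξ := setIntegral_le_integral (hν.integrable_one_sub_cos ξ)
        (hν.nonneg_ae.mono fun z hz => mul_nonneg (one_sub_cos_nonneg _) hz.le)

theorem exists_pos_le_ψ [NeZero d] (hν : IsUnimodalLevy d ν) {δ : ℝ} (hδ : 0 < δ) :
    ∃ m : ℝ, 0 < m ∧ ∀ ξ : EuclideanSpace ℝ (Fin d), δ ≤ ‖ξ‖ → m ≤ ψ d ν ξ := by
  obtain ⟨m₁, hm₁, h₁⟩ := hν.exists_pos_le_ψ_cocompact
  obtain ⟨C, hC, hC'⟩ := mem_cocompact.mp h₁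
  have hK : IsCompact (C ∩ {ξ | δ ≤ ‖ξ‖}) :=
    hC.inter_right (isClosed_le continuous_const continuous_norm)
  rcases (C ∩ {ξ | δ ≤ ‖ξ‖}).eq_empty_or_nonempty with he | hne
  · refine ⟨m₁, hm₁, fun ξ hξ => hC' fun hξC => ?_⟩
    exact (he ▸ (⟨hξC, hξ⟩ : ξ ∈ C ∩ {ξ | δ ≤ ‖ξ‖}) : ξ ∈ (∅ : Set _))
  · obtain ⟨ζ, hζ, hmin⟩ := hK.exists_isMinOn hne hν.continuous_ψ.continuousOn
    have hζ0 : 0 < ψ d ν ζ := hν.ψ_pos (norm_pos_iff.mp (hδ.trans_le hζ.2))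
    refine ⟨min m₁ (ψ d ν ζ), lt_min hm₁ hζ0, fun ξ hξ => ?_⟩
    by_cases hξC : ξ ∈ C
    · exact (min_le_right _ _).trans (hmin ⟨hξC, hξ⟩)
    · exact (min_le_left _ _).trans (hC' hξC)

end IsUnimodalLevy

theorem ψstar_eq_sSup_image (d : ℕ) (ν : ℝ → ℝ) {r : ℝ} (hr : 0 ≤ r) :
    ψstar d ν r =
      sSup ((fun z : EuclideanSpace ℝ (Fin d) => ψ d ν (r • z)) '' Metric.closedBall 0 1) := by
  have hball := smul_unitClosedBall_of_nonneg (E := EuclideanSpace ℝ (Fin d)) hr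
  change _ = sSup ((ψ d ν ∘ fun z => r • z) '' _)
  rw [ψstar, Set.image_comp, Set.image_smul, hball]
  congr 1
  ext y
  simp

namespace IsUnimodalLevy

variable {d : ℕ} {ν : ℝ → ℝ}

theorem continuousOn_ψstar [NeZero d] (hν : IsUnimodalLevy d ν) :
    ContinuousOn (ψstar d ν) (Set.Ici 0) := by
  have h : Continuous fun r : ℝ =>
      sSup ((fun z : EuclideanSpace ℝ (Fin d) => ψ d ν (r • z)) '' Metric.closedBall 0 1) :=
    (isCompact_closedBall 0 1).continuous_sSup (hν.continuous_ψ.comp continuous_smul)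
  exact h.continuousOn.congr fun r hr => ψstar_eq_sSup_image d ν hr

theorem ψ_le_ψstar [NeZero d] (hν : IsUnimodalLevy d ν) {z : EuclideanSpace ℝ (Fin d)} {r : ℝ}
    (hz : ‖z‖ ≤ r) : ψ d ν z ≤ ψstar d ν r := by
  have hbdd := (isCompact_closedBall (0 : EuclideanSpace ℝ (Fin d)) r).bddAbove_image
    hν.continuous_ψ.continuousOn
  refine le_csSup (hbdd.mono ?_) ⟨z, hz, rfl⟩
  rintro y ⟨w, hw, rfl⟩
  exact ⟨w, mem_closedBall_zero_iff.mpr hw, rfl⟩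

end IsUnimodalLevy

theorem ψstar_le {d : ℕ} {ν : ℝ → ℝ} {r B : ℝ} (hr : 0 ≤ r)
    (hB : ∀ z : EuclideanSpace ℝ (Fin d), ‖z‖ ≤ r → ψ d ν z ≤ B) : ψstar d ν r ≤ B := by
  refine csSup_le ⟨_, 0, by simpa using hr, rfl⟩ ?_
  rintro y ⟨z, hz, rfl⟩
  exact hB z hz

theorem exists_norm_eq_one (d : ℕ) [NeZero d] : ∃ e : EuclideanSpace ℝ (Fin d), ‖e‖ = 1 :=
  ⟨EuclideanSpace.single 0 1, by simp⟩

theorem ψstar_zero (d : ℕ) (ν : ℝ → ℝ) : ψstar d ν 0 = 0 := by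
  simp [ψstar, ψ_zero]

namespace IsUnimodalLevy

variable {d : ℕ} {ν : ℝ → ℝ}

theorem ψstar_mono [NeZero d] (hν : IsUnimodalLevy d ν) {r r' : ℝ} (hr : 0 ≤ r) (h : r ≤ r') :
    ψstar d ν r ≤ ψstar d ν r' :=
  ψstar_le hr fun _ hz => hν.ψ_le_ψstar (hz.trans h)

theorem ψstar_pos [NeZero d] (hν : IsUnimodalLevy d ν) {r : ℝ} (hr : 0 < r) :
    0 < ψstar d ν r := by
  obtain ⟨e, he⟩ := exists_norm_eq_one d
  have hre : ‖r • e‖ = r := by rw [norm_smul, he, mul_one, Real.norm_of_nonneg hr.le]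
  exact (hν.ψ_pos (norm_pos_iff.mp (hr.trans_eq hre.symm))).trans_le (hν.ψ_le_ψstar hre.le)

theorem ψinv_spec [NeZero d] (hν : IsUnimodalLevy d ν) {u δ : ℝ} (hδ : 0 < δ) (hu : 0 < u)
    (huδ : u < ψstar d ν δ) :
    0 < ψinv d ν u ∧ ψinv d ν u < δ ∧ ψstar d ν (ψinv d ν u) = u := by
  set S := {r : ℝ | 0 ≤ r ∧ ψstar d ν r = u} with hS
  have hlt : ∀ r ∈ S, r < δ := fun r hr => by
    by_contra! h
    exact (huδ.trans_le (hν.ψstar_mono hδ.le h)).ne' hr.2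
  have hne : S.Nonempty := by
    obtain ⟨r, hr, hru⟩ := intermediate_value_Icc hδ.le
      (hν.continuousOn_ψstar.mono Set.Icc_subset_Ici_self)
      (show u ∈ Set.Icc (ψstar d ν 0) (ψstar d ν δ) from ⟨by rw [ψstar_zero]; exact hu.le, huδ.le⟩)
    exact ⟨r, hr.1, hru⟩
  have hcl : IsClosed S :=
    hν.continuousOn_ψstar.preimage_isClosed_of_isClosed isClosed_Ici isClosed_singleton
  have hmem : sSup S ∈ S := hcl.csSup_mem hne ⟨δ, fun r hr => (hlt r hr).le⟩
  refine ⟨lt_of_le_of_ne hmem.1 fun h => ?_, hlt _ hmem, hmem.2⟩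
  have h2 : ψstar d ν (ψinv d ν u) = u := hmem.2
  rw [← h, ψstar_zero] at h2
  exact hu.ne h2

theorem eventually_ψinv_spec [NeZero d] (hν : IsUnimodalLevy d ν) {δ : ℝ} (hδ : 0 < δ) :
    ∀ᶠ s : ℝ in atTop, 0 < ψinv d ν (1 / s) ∧ ψinv d ν (1 / s) < δ ∧
      ψstar d ν (ψinv d ν (1 / s)) = 1 / s := by
  filter_upwards [eventually_gt_atTop 0, eventually_gt_atTop (1 / ψstar d ν δ)] with s hs hs'
  exact hν.ψinv_spec hδ (one_div_pos.mpr hs) ((one_div_lt (hν.ψstar_pos hδ) hs).mp hs')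

theorem tendsto_inv_ψinv [NeZero d] (hν : IsUnimodalLevy d ν) :
    Tendsto (fun s : ℝ => (ψinv d ν (1 / s))⁻¹) atTop atTop := by
  refine tendsto_atTop.mpr fun b => ?_
  filter_upwards [hν.eventually_ψinv_spec (δ := (max b 1)⁻¹) (by positivity)] with s hs
  exact (le_max_left b 1).trans ((le_inv_comm₀ (by positivity) hs.1).mpr hs.2.1.le)

end IsUnimodalLevy

theorem exists_potter_bounds {ν : ℝ → ℝ} {ρ γ₁ γ₂ : ℝ} (hpos : ∀ r : ℝ, 0 < r → 0 < ν r)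
    (hanti : ∀ r₁ r₂ : ℝ, 0 < r₁ → r₁ ≤ r₂ → ν r₂ ≤ ν r₁)
    (hlim : Tendsto (fun r : ℝ => ν (2 * r) / ν r) atTop (nhds (2 ^ (-ρ))))
    (h₀ : 0 ≤ γ₁) (h₁ : γ₁ < ρ) (h₂ : ρ < γ₂) :
    ∃ M : ℝ, 1 ≤ M ∧ ∃ C : ℝ, 0 < C ∧ ∀ L : ℝ, M ≤ L → ∀ lam : ℝ, 1 ≤ lam →
      ν (lam * L) ≤ C * lam ^ (-γ₁) * ν L ∧ ν L ≤ C * lam ^ γ₂ * ν (lam * L) := by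
  have e₁ : (2 : ℝ) ^ (-ρ) < 2 ^ (-γ₁) := Real.rpow_lt_rpow_of_exponent_lt one_lt_two (by linarith)
  have e₂ : (2 : ℝ) ^ (-γ₂) < 2 ^ (-ρ) := Real.rpow_lt_rpow_of_exponent_lt one_lt_two (by linarith)
  obtain ⟨M₀, hM₀⟩ := eventually_atTop.mp
    ((hlim.eventually_lt_const e₁).and (hlim.eventually_const_lt e₂))
  have hγ₂ : 0 ≤ γ₂ := by linarith
  have step : ∀ n : ℕ, ∀ L, max M₀ 1 ≤ L →
      ν (2 ^ n * L) ≤ ((2 : ℝ) ^ n) ^ (-γ₁) * ν L ∧ ν L ≤ ((2 : ℝ) ^ n) ^ γ₂ * ν (2 ^ n * L) := by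
    intro n
    induction n with
    | zero => intro L _; simp
    | succ n ih =>
      intro L hL
      have hL1 : 1 ≤ L := (le_max_right _ _).trans hL
      have hn : (1 : ℝ) ≤ 2 ^ n := one_le_pow₀ one_le_two
      have hnL : max M₀ 1 ≤ 2 ^ n * L := hL.trans (le_mul_of_one_le_left (by linarith) hn)
      have hp : 0 < ν (2 ^ n * L) := hpos _ (by positivity)
      obtain ⟨a, b⟩ := hM₀ (2 ^ n * L) ((le_max_left _ _).trans hnL)
      rw [div_lt_iff₀ hp] at a
      rw [lt_div_iff₀ hp, Real.rpow_neg two_pos.le, inv_mul_lt_iff₀ (by positivity)] at b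
      obtain ⟨c, e⟩ := ih L hL
      have hexp (γ : ℝ) : ((2 : ℝ) ^ (n + 1)) ^ γ = 2 ^ γ * (2 ^ n) ^ γ := by
        rw [pow_succ', Real.mul_rpow two_pos.le (by positivity)]
      have harg : (2 : ℝ) ^ (n + 1) * L = 2 * (2 ^ n * L) := by ring
      rw [hexp, hexp, harg]
      constructor
      · calc ν (2 * (2 ^ n * L)) ≤ 2 ^ (-γ₁) * ν (2 ^ n * L) := a.le
          _ ≤ 2 ^ (-γ₁) * (((2 : ℝ) ^ n) ^ (-γ₁) * ν L) := by gcongr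
          _ = _ := by ring
      · calc ν L ≤ ((2 : ℝ) ^ n) ^ γ₂ * ν (2 ^ n * L) := e
          _ ≤ ((2 : ℝ) ^ n) ^ γ₂ * (2 ^ γ₂ * ν (2 * (2 ^ n * L))) := by gcongr
          _ = _ := by ring
  refine ⟨max M₀ 1, le_max_right _ _, 2 ^ γ₂, by positivity, fun L hL lam hlam => ?_⟩
  have hL0 : 0 < L := one_pos.trans_le ((le_max_right _ _).trans hL)
  have hl0 : 0 < lam := one_pos.trans_le hlam
  obtain ⟨n, hn, hn'⟩ := exists_nat_pow_near hlam one_lt_two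
  have hνL := hpos L hL0
  have hνl := hpos (lam * L) (by positivity)
  constructor
  · calc ν (lam * L) ≤ ν (2 ^ n * L) := hanti _ _ (by positivity) (by gcongr)
      _ ≤ ((2 : ℝ) ^ n) ^ (-γ₁) * ν L := (step n L hL).1
      _ = 2 ^ γ₁ * ((2 : ℝ) ^ (n + 1)) ^ (-γ₁) * ν L := by
        rw [pow_succ', Real.mul_rpow two_pos.le (by positivity), ← mul_assoc (_ ^ _),
          ← Real.rpow_add two_pos]
        simp
      _ ≤ 2 ^ γ₂ * lam ^ (-γ₁) * ν L := by
        refine mul_le_mul_of_nonneg_right (mul_le_mul ?_ ?_ (by positivity) (by positivity)) hνL.le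
        · exact Real.rpow_le_rpow_of_exponent_le one_le_two (by linarith)
        · exact Real.rpow_le_rpow_of_nonpos hl0 hn'.le (by linarith)
  · calc ν L ≤ ((2 : ℝ) ^ (n + 1)) ^ γ₂ * ν (2 ^ (n + 1) * L) := (step (n + 1) L hL).2
      _ = 2 ^ γ₂ * ((2 : ℝ) ^ n) ^ γ₂ * ν (2 ^ (n + 1) * L) := by
        rw [pow_succ', Real.mul_rpow two_pos.le (by positivity)]
      _ ≤ 2 ^ γ₂ * lam ^ γ₂ * ν (lam * L) := by
        have h3 : ν (2 ^ (n + 1) * L) ≤ ν (lam * L) := hanti _ _ (by positivity) (by gcongr)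
        have h4 := (hpos (2 ^ (n + 1) * L) (by positivity)).le
        gcongr

theorem integrable_min_mul_rpow {d : ℕ} [NeZero d] {γ : ℝ} (h₁ : d < γ) (h₂ : γ < d + 2) :
    Integrable (fun w : EuclideanSpace ℝ (Fin d) => min (‖w‖ ^ 2) 1 * ‖w‖ ^ (-γ)) := by
  refine (integrable_fun_norm_addHaar volume (f := fun y => min (y ^ 2) 1 * y ^ (-γ))).mpr ?_
  rw [finrank_euclideanSpace_fin, ← Set.Ioc_union_Ioi_eq_Ioi zero_le_one]
  have hd : ((d - 1 : ℕ) : ℝ) = d - 1 := by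
    rw [Nat.cast_sub (NeZero.one_le), Nat.cast_one]
  refine IntegrableOn.union ?_ ?_
  · have h : IntegrableOn (fun y : ℝ => y ^ ((d : ℝ) + 1 - γ)) (Set.Ioc 0 1) :=
      (intervalIntegral.intervalIntegrable_rpow' (by linarith)).1
    refine h.congr_fun (fun y hy => ?_) measurableSet_Ioc
    have : y ^ 2 ≤ 1 := pow_le_one₀ hy.1.le hy.2
    simp only [smul_eq_mul]
    rw [min_eq_left this, ← Real.rpow_natCast, ← Real.rpow_natCast y 2, ← Real.rpow_add hy.1,
      ← Real.rpow_add hy.1, hd]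
    congr 1
    push_cast
    ring
  · have h : IntegrableOn (fun y : ℝ => y ^ ((d : ℝ) - 1 - γ)) (Set.Ioi 1) :=
      integrableOn_Ioi_rpow_of_lt (by linarith) one_pos
    refine h.congr_fun (fun y (hy : 1 < y) => ?_) measurableSet_Ioi
    have : 1 ≤ y ^ 2 := one_le_pow₀ hy.le
    simp only [smul_eq_mul]
    rw [min_eq_right this, one_mul, ← Real.rpow_natCast, ← Real.rpow_add (by linarith), hd]
    rfl

theorem isUnimodalLevy_rpow {d : ℕ} [NeZero d] {γ : ℝ} (h₁ : d < γ) (h₂ : γ < d + 2) :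
    IsUnimodalLevy d fun r => r ^ (-γ) where
  pos r hr := Real.rpow_pos_of_pos hr _
  anti r₁ r₂ h h' := Real.rpow_le_rpow_of_nonpos h h'
    (by have : (0 : ℝ) ≤ d := Nat.cast_nonneg d
        linarith)
  integrable := integrable_min_mul_rpow h₁ h₂

theorem integrable_exp_neg_mul_norm_rpow {d : ℕ} [NeZero d] {b β : ℝ} (hb : 0 < b) (hβ : 0 < β) :
    Integrable (fun ξ : EuclideanSpace ℝ (Fin d) => Real.exp (-(b * ‖ξ‖ ^ β))) := by
  refine (integrable_fun_norm_addHaar volume (f := fun y => Real.exp (-(b * y ^ β)))).mpr ?_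
  have h := integrableOn_rpow_mul_exp_neg_mul_rpow (p := β) (s := (d - 1 : ℕ)) (b := b)
    (neg_one_lt_zero.trans_le (Nat.cast_nonneg _)) hβ hb
  simpa [finrank_euclideanSpace_fin, Real.rpow_natCast] using h

/-- Two-sided power bounds for the ratios `ν (lam * L) / ν L` with `L ≥ M` and `lam ≥ 1`. -/
structure PotterBounds (ν : ℝ → ℝ) (γ₁ γ₂ M C : ℝ) : Prop where
  one_le : 1 ≤ M
  const_pos : 0 < C
  upper : ∀ L : ℝ, M ≤ L → ∀ lam : ℝ, 1 ≤ lam → ν (lam * L) ≤ C * lam ^ (-γ₁) * ν L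
  lower : ∀ L : ℝ, M ≤ L → ∀ lam : ℝ, 1 ≤ lam → ν L ≤ C * lam ^ γ₂ * ν (lam * L)

/-- The distance, in the weighted `L¹` space attached to Lévy measures, between the profile `ν`
rescaled by `L` and the power profile of the `α`-stable process. -/
def profileDist (d : ℕ) (ν : ℝ → ℝ) (α L : ℝ) : ℝ :=
  ∫ w : EuclideanSpace ℝ (Fin d),
    min (‖w‖ ^ 2) 1 * |ν (L * ‖w‖) / ν L - ‖w‖ ^ (-((d : ℝ) + α))|

theorem PotterBounds.ratio_le {ν : ℝ → ℝ} {γ₁ γ₂ M C : ℝ} (hP : PotterBounds ν γ₁ γ₂ M C)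
    (hpos : ∀ r : ℝ, 0 < r → 0 < ν r) {L x : ℝ} (hL : M ≤ L) (hx : 0 < x) (hLx : M ≤ L * x) :
    ν (L * x) / ν L ≤ C * (x ^ (-γ₁) + x ^ (-γ₂)) := by
  have hL0 : 0 < L := one_pos.trans_le (hP.one_le.trans hL)
  have hC := hP.const_pos
  rw [div_le_iff₀ (hpos L hL0), mul_add, add_mul]
  have h1 : 0 < C * x ^ (-γ₁) * ν L := by have := hpos L hL0; positivity
  have h2 : 0 < C * x ^ (-γ₂) * ν L := by have := hpos L hL0; positivity
  rcases le_total 1 x with h | h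
  · have := hP.upper L hL x h
    rw [mul_comm x L] at this
    linarith
  · have := hP.lower (L * x) hLx x⁻¹ ((one_le_inv₀ hx).mpr h)
    rw [Real.inv_rpow hx.le, ← Real.rpow_neg hx.le, mul_comm L x, inv_mul_cancel_left₀ hx.ne',
      mul_comm x L] at this
    linarith

theorem PotterBounds.inv_le {ν : ℝ → ℝ} {γ₁ γ₂ M C : ℝ} (hP : PotterBounds ν γ₁ γ₂ M C)
    (hpos : ∀ r : ℝ, 0 < r → 0 < ν r) {L : ℝ} (hL : M ≤ L) :
    (ν L)⁻¹ ≤ C * M ^ (-γ₂) / ν M * L ^ γ₂ := by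
  have hM0 : 0 < M := one_pos.trans_le hP.one_le
  have hL0 : 0 < L := hM0.trans_le hL
  have h := hP.lower M le_rfl (L / M) ((one_le_div hM0).mpr hL)
  rw [div_mul_cancel₀ _ hM0.ne', Real.div_rpow hL0.le hM0.le] at h
  have h1 := hpos L hL0
  have h2 := hpos M hM0
  rw [inv_le_iff_one_le_mul₀ h1, Real.rpow_neg hM0.le]
  calc 1 = ν M / ν M := (div_self h2.ne').symm
    _ ≤ C * (L ^ γ₂ / M ^ γ₂) * ν L / ν M := by gcongr
    _ = _ := by ring

theorem PotterBounds.le {ν : ℝ → ℝ} {γ₁ γ₂ M C : ℝ} (hP : PotterBounds ν γ₁ γ₂ M C) {L : ℝ}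
    (hL : M ≤ L) : ν L ≤ C * M ^ γ₁ * ν M * L ^ (-γ₁) := by
  have hM0 : 0 < M := one_pos.trans_le hP.one_le
  have hL0 : 0 < L := hM0.trans_le hL
  have h := hP.upper M le_rfl (L / M) ((one_le_div hM0).mpr hL)
  rw [div_mul_cancel₀ _ hM0.ne', Real.div_rpow hL0.le hM0.le, Real.rpow_neg hM0.le, div_inv_eq_mul]
    at h
  linarith

namespace IsUnimodalLevy

variable {d : ℕ} {ν : ℝ → ℝ} {α : ℝ}

theorem integrable_comp_mul [NeZero d] (hν : IsUnimodalLevy d ν) {L : ℝ} (hL : 1 ≤ L) :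
    Integrable (fun w : EuclideanSpace ℝ (Fin d) => min (‖w‖ ^ 2) 1 * ν (L * ‖w‖)) := by
  have hL0 : 0 < L := one_pos.trans_le hL
  refine (hν.integrable.comp_smul hL0.ne').mono'
    (AEStronglyMeasurable.mul (Continuous.aestronglyMeasurable (by fun_prop))
      (hν.aestronglyMeasurable hL0)) ?_
  filter_upwards [ae_ne_zero] with w hw
  have hp := hν.pos (L * ‖w‖) (mul_pos hL0 (norm_pos_iff.mpr hw))
  rw [Real.norm_of_nonneg (by positivity), norm_smul, Real.norm_of_nonneg hL0.le]
  have : ‖w‖ ≤ L * ‖w‖ := le_mul_of_one_le_left (norm_nonneg _) hL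
  gcongr

theorem integrable_profile [NeZero d] (hν : IsUnimodalLevy d ν) (hα : α ∈ Set.Ioo (0 : ℝ) 2)
    {L : ℝ} (hL : 1 ≤ L) :
    Integrable (fun w : EuclideanSpace ℝ (Fin d) =>
      min (‖w‖ ^ 2) 1 * |ν (L * ‖w‖) / ν L - ‖w‖ ^ (-((d : ℝ) + α))|) := by
  have h := ((hν.integrable_comp_mul hL).div_const (ν L)).sub
    (integrable_min_mul_rpow (d := d) (γ := d + α) (by linarith [hα.1]) (by linarith [hα.2]))
  refine h.abs.congr (Eventually.of_forall fun w => ?_)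
  simp only [Pi.sub_apply]
  rw [mul_div_assoc, ← mul_sub, abs_mul, abs_of_nonneg (a := min (‖w‖ ^ 2) 1) (by positivity)]

theorem tendsto_integral_near_origin [NeZero d] (hν : IsUnimodalLevy d ν) {γ₁ γ₂ M C : ℝ}
    (hP : PotterBounds ν γ₁ γ₂ M C) (hγ₂ : γ₂ < d + 2) :
    Tendsto (fun L : ℝ => ∫ w : EuclideanSpace ℝ (Fin d),
      M ^ 2 * (L ^ 2)⁻¹ * (ν L)⁻¹ * (min (‖L • w‖ ^ 2) 1 * ν ‖L • w‖)) atTop (nhds 0) := by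
  set I := ∫ z : EuclideanSpace ℝ (Fin d), min (‖z‖ ^ 2) 1 * ν ‖z‖ with hI
  have hI0 : 0 ≤ I := integral_nonneg_of_ae
    (hν.nonneg_ae.mono fun z hz => mul_nonneg (by positivity) hz.le)
  have hlim : Tendsto (fun L : ℝ => M ^ 2 * (C * M ^ (-γ₂) / ν M) * I * L ^ (-(d + 2 - γ₂)))
      atTop (nhds 0) := by
    simpa using (tendsto_rpow_neg_atTop (y := d + 2 - γ₂) (by linarith)).const_mul
      (M ^ 2 * (C * M ^ (-γ₂) / ν M) * I)
  refine tendsto_of_tendsto_of_tendsto_of_le_of_le' tendsto_const_nhds hlim ?_ ?_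
  · filter_upwards [eventually_gt_atTop 0] with L hL
    refine integral_nonneg_of_ae ?_
    filter_upwards [ae_ne_zero] with w hw
    have h1 := hν.pos L hL
    have h2 := hν.pos ‖L • w‖ (norm_pos_iff.mpr (smul_ne_zero hL.ne' hw))
    simp only [Pi.zero_apply]
    positivity
  · filter_upwards [eventually_ge_atTop M] with L hL
    have hL0 : 0 < L := one_pos.trans_le (hP.one_le.trans hL)
    have hLd : 0 < L ^ d := pow_pos hL0 d
    rw [integral_const_mul, Measure.integral_comp_smul volume
      (fun z : EuclideanSpace ℝ (Fin d) => min (‖z‖ ^ 2) 1 * ν ‖z‖), finrank_euclideanSpace_fin,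
      abs_of_pos (inv_pos.mpr hLd), smul_eq_mul, ← hI]
    have hexp : L ^ (-((d : ℝ) + 2 - γ₂)) = (L ^ 2)⁻¹ * L ^ γ₂ * (L ^ d)⁻¹ := by
      rw [← Real.rpow_natCast L d, ← Real.rpow_natCast L 2, ← Real.rpow_neg hL0.le,
        ← Real.rpow_neg hL0.le, ← Real.rpow_add hL0, ← Real.rpow_add hL0]
      congr 1
      push_cast
      ring
    calc M ^ 2 * (L ^ 2)⁻¹ * (ν L)⁻¹ * ((L ^ d)⁻¹ * I)
        ≤ M ^ 2 * (L ^ 2)⁻¹ * (C * M ^ (-γ₂) / ν M * L ^ γ₂) * ((L ^ d)⁻¹ * I) := by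
          have := hP.inv_le hν.pos hL
          gcongr
      _ = _ := by rw [hexp]; ring

theorem aestronglyMeasurable_truncated [NeZero d] (hν : IsUnimodalLevy d ν) {M L : ℝ}
    (hL : 0 < L) :
    AEStronglyMeasurable (fun w : EuclideanSpace ℝ (Fin d) => min (‖w‖ ^ 2) 1 *
      |{w : EuclideanSpace ℝ (Fin d) | M ≤ L * ‖w‖}.indicator (fun w => ν (L * ‖w‖) / ν L) w -
        ‖w‖ ^ (-((d : ℝ) + α))|) := by
  have h1 : AEStronglyMeasurable (fun w : EuclideanSpace ℝ (Fin d) =>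
      {w : EuclideanSpace ℝ (Fin d) | M ≤ L * ‖w‖}.indicator (fun w => ν (L * ‖w‖) / ν L) w) :=
    ((hν.aestronglyMeasurable hL).mul_const (ν L)⁻¹).indicator
      (measurableSet_le measurable_const (measurable_norm.const_mul L))
  have h2 : AEStronglyMeasurable (fun w : EuclideanSpace ℝ (Fin d) => ‖w‖ ^ (-((d : ℝ) + α))) :=
    (measurable_norm.pow_const _).aestronglyMeasurable
  exact AEStronglyMeasurable.mul (Continuous.aestronglyMeasurable (by fun_prop)) (h1.sub h2).norm

theorem tendsto_integral_away_from_origin [NeZero d] (hν : IsUnimodalLevy d ν)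
    (hα : α ∈ Set.Ioo (0 : ℝ) 2)
    (hA2 : ∀ lam : ℝ, 0 < lam →
      Tendsto (fun r : ℝ => ν (lam * r) / ν r) atTop (nhds (lam ^ (-(d : ℝ) - α))))
    {γ₁ γ₂ M C : ℝ} (hP : PotterBounds ν γ₁ γ₂ M C) (h₁ : d < γ₁) (h₁' : γ₁ < d + 2)
    (h₂ : d < γ₂) (h₂' : γ₂ < d + 2) :
    Tendsto (fun L : ℝ => ∫ w : EuclideanSpace ℝ (Fin d), min (‖w‖ ^ 2) 1 *
      |{w : EuclideanSpace ℝ (Fin d) | M ≤ L * ‖w‖}.indicator (fun w => ν (L * ‖w‖) / ν L) w -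
        ‖w‖ ^ (-((d : ℝ) + α))|) atTop (nhds 0) := by
  have hp := integrable_min_mul_rpow (d := d) (γ := d + α) (by linarith [hα.1]) (by linarith [hα.2])
  have hb := (((integrable_min_mul_rpow h₁ h₁').add (integrable_min_mul_rpow h₂ h₂')).const_mul
    C).add hp
  have hC := hP.const_pos
  rw [← integral_zero (EuclideanSpace ℝ (Fin d)) ℝ (μ := volume)]
  refine tendsto_integral_filter_of_dominated_convergence _ ?_ ?_ hb ?_
  · filter_upwards [eventually_gt_atTop 0] with L hL
    exact hν.aestronglyMeasurable_truncated hL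
  · filter_upwards [eventually_ge_atTop M] with L hL
    have hL0 : 0 < L := one_pos.trans_le (hP.one_le.trans hL)
    filter_upwards [ae_ne_zero] with w hw
    have hw0 := norm_pos_iff.mpr hw
    have hq : {w : EuclideanSpace ℝ (Fin d) | M ≤ L * ‖w‖}.indicator
        (fun w => ν (L * ‖w‖) / ν L) w ≤ C * (‖w‖ ^ (-γ₁) + ‖w‖ ^ (-γ₂)) :=
      Set.indicator_apply_le' (fun h => hP.ratio_le hν.pos hL hw0 h) fun _ => by positivity
    have hq0 : 0 ≤ {w : EuclideanSpace ℝ (Fin d) | M ≤ L * ‖w‖}.indicator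
        (fun w => ν (L * ‖w‖) / ν L) w := by
      refine Set.indicator_apply_nonneg fun _ => ?_
      exact (div_pos (hν.pos _ (mul_pos hL0 hw0)) (hν.pos L hL0)).le
    have hp0 : 0 ≤ ‖w‖ ^ (-((d : ℝ) + α)) := by positivity
    rw [Real.norm_of_nonneg (by positivity)]
    simp only [Pi.add_apply]
    rw [← mul_add, mul_left_comm, ← mul_add]
    refine mul_le_mul_of_nonneg_left ?_ (by positivity)
    exact abs_le.mpr ⟨by linarith, by linarith⟩
  · filter_upwards [ae_ne_zero] with w hw
    have hw0 := norm_pos_iff.mpr hw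
    have h1 : Tendsto (fun L : ℝ => ν (L * ‖w‖) / ν L) atTop (nhds (‖w‖ ^ (-((d : ℝ) + α)))) := by
      rw [neg_add']
      exact (hA2 ‖w‖ hw0).congr fun L => by rw [mul_comm]
    have h2 : Tendsto (fun L : ℝ => min (‖w‖ ^ 2) 1 *
        |ν (L * ‖w‖) / ν L - ‖w‖ ^ (-((d : ℝ) + α))|) atTop (nhds 0) := by
      simpa using ((h1.sub_const (‖w‖ ^ (-((d : ℝ) + α)))).abs.const_mul (min (‖w‖ ^ 2) 1))
    refine h2.congr' ?_
    filter_upwards [eventually_ge_atTop (M / ‖w‖)] with L hL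
    rw [Set.indicator_of_mem]
    exact (div_le_iff₀ hw0).mp hL

theorem exists_potterBounds [NeZero d] (hν : IsUnimodalLevy d ν) (hα : α ∈ Set.Ioo (0 : ℝ) 2)
    (hA2 : ∀ lam : ℝ, 0 < lam →
      Tendsto (fun r : ℝ => ν (lam * r) / ν r) atTop (nhds (lam ^ (-(d : ℝ) - α)))) :
    ∃ γ₁ γ₂ M C : ℝ, d < γ₁ ∧ γ₁ < d + 2 ∧ d < γ₂ ∧ γ₂ < d + 2 ∧ PotterBounds ν γ₁ γ₂ M C := by
  obtain ⟨hα0, hα2⟩ := hα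
  have hlim := hA2 2 two_pos
  rw [← neg_add'] at hlim
  obtain ⟨M, hM, C, hC, h⟩ := exists_potter_bounds (γ₁ := d + α / 2) (γ₂ := d + (α + 2) / 2)
    hν.pos hν.anti hlim (by positivity) (by linarith) (by linarith)
  exact ⟨_, _, M, C, by linarith, by linarith, by linarith, by linarith, hM, hC,
    fun L hL lam hl => (h L hL lam hl).1, fun L hL lam hl => (h L hL lam hl).2⟩

theorem tendsto_profileDist [NeZero d] (hν : IsUnimodalLevy d ν) (hα : α ∈ Set.Ioo (0 : ℝ) 2)
    (hA2 : ∀ lam : ℝ, 0 < lam →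
      Tendsto (fun r : ℝ => ν (lam * r) / ν r) atTop (nhds (lam ^ (-(d : ℝ) - α)))) :
    Tendsto (profileDist d ν α) atTop (nhds 0) := by
  obtain ⟨γ₁, γ₂, M, C, h₁, h₁', h₂, h₂', hP⟩ := hν.exists_potterBounds hα hA2
  have hC := hP.const_pos
  have hp := integrable_min_mul_rpow (d := d) (γ := d + α) (by linarith [hα.1]) (by linarith [hα.2])
  have hlim := (hν.tendsto_integral_away_from_origin hα hA2 hP h₁ h₁' h₂ h₂').add
    (hν.tendsto_integral_near_origin hP h₂')
  rw [add_zero] at hlim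
  refine tendsto_of_tendsto_of_tendsto_of_le_of_le' tendsto_const_nhds hlim ?_ ?_
  · exact Eventually.of_forall fun L => integral_nonneg fun w => by positivity
  filter_upwards [eventually_ge_atTop M] with L hL
  have hL1 : 1 ≤ L := hP.one_le.trans hL
  have hL0 : 0 < L := one_pos.trans_le hL1
  have hνL := hν.pos L hL0
  have hA : Integrable (fun w : EuclideanSpace ℝ (Fin d) => min (‖w‖ ^ 2) 1 *
      |{w : EuclideanSpace ℝ (Fin d) | M ≤ L * ‖w‖}.indicator (fun w => ν (L * ‖w‖) / ν L) w -
        ‖w‖ ^ (-((d : ℝ) + α))|) := by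
    refine ((hν.integrable_profile hα hL1).add hp).mono' ?_ ?_
    · exact hν.aestronglyMeasurable_truncated hL0
    · refine Eventually.of_forall fun w => ?_
      rw [Real.norm_of_nonneg (by positivity)]
      simp only [Pi.add_apply]
      rw [← mul_add]
      refine mul_le_mul_of_nonneg_left ?_ (by positivity)
      have hp0 : 0 ≤ ‖w‖ ^ (-((d : ℝ) + α)) := by positivity
      by_cases hw : M ≤ L * ‖w‖
      · rw [Set.indicator_of_mem (by exact hw)]
        linarith
      · rw [Set.indicator_of_notMem (by exact hw), zero_sub, abs_neg, abs_of_nonneg hp0]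
        exact le_add_of_nonneg_left (abs_nonneg _)
  have hB : Integrable (fun w : EuclideanSpace ℝ (Fin d) =>
      M ^ 2 * (L ^ 2)⁻¹ * (ν L)⁻¹ * (min (‖L • w‖ ^ 2) 1 * ν ‖L • w‖)) :=
    (hν.integrable.comp_smul hL0.ne').const_mul _
  rw [profileDist, ← integral_add hA hB]
  refine integral_mono_ae (hν.integrable_profile hα hL1) (hA.add hB) ?_
  filter_upwards [ae_ne_zero] with w hw
  have hw0 := norm_pos_iff.mpr hw
  have hνw := hν.pos (L * ‖w‖) (mul_pos hL0 hw0)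
  have hp0 : 0 ≤ ‖w‖ ^ (-((d : ℝ) + α)) := by positivity
  rw [norm_smul, Real.norm_of_nonneg hL0.le]
  by_cases hwM : M ≤ L * ‖w‖
  · rw [Set.indicator_of_mem (by exact hwM)]
    exact le_add_of_nonneg_right (by positivity)
  · rw [Set.indicator_of_notMem (by exact hwM), zero_sub, abs_neg, abs_of_nonneg hp0]
    have hM2 : (L * ‖w‖) ^ 2 ≤ M ^ 2 * min ((L * ‖w‖) ^ 2) 1 := by
      have hM1 : 1 ≤ M ^ 2 := one_le_pow₀ hP.one_le
      have h3 : (L * ‖w‖) ^ 2 ≤ M ^ 2 := pow_le_pow_left₀ (by positivity) (not_le.mp hwM).le 2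
      rcases min_cases ((L * ‖w‖) ^ 2) 1 with ⟨h, _⟩ | ⟨h, _⟩ <;> rw [h]
      · exact le_mul_of_one_le_left (by positivity) hM1
      · simpa using h3
    have hmin : min (‖w‖ ^ 2) 1 ≤ M ^ 2 * (L ^ 2)⁻¹ * min ((L * ‖w‖) ^ 2) 1 := by
      refine (min_le_left _ _).trans ?_
      calc ‖w‖ ^ 2 = (L ^ 2)⁻¹ * (L * ‖w‖) ^ 2 := by field_simp
        _ ≤ (L ^ 2)⁻¹ * (M ^ 2 * min ((L * ‖w‖) ^ 2) 1) := by gcongr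
        _ = _ := by ring
    calc min (‖w‖ ^ 2) 1 * |ν (L * ‖w‖) / ν L - ‖w‖ ^ (-((d : ℝ) + α))|
        ≤ min (‖w‖ ^ 2) 1 * (‖w‖ ^ (-((d : ℝ) + α)) + ν (L * ‖w‖) / ν L) := by
          refine mul_le_mul_of_nonneg_left ?_ (by positivity)
          have : 0 < ν (L * ‖w‖) / ν L := by positivity
          exact abs_le.mpr ⟨by linarith, by linarith⟩
      _ = min (‖w‖ ^ 2) 1 * ‖w‖ ^ (-((d : ℝ) + α)) + min (‖w‖ ^ 2) 1 * (ν (L * ‖w‖) / ν L) :=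
          mul_add _ _ _
      _ ≤ min (‖w‖ ^ 2) 1 * ‖w‖ ^ (-((d : ℝ) + α)) +
          M ^ 2 * (L ^ 2)⁻¹ * min ((L * ‖w‖) ^ 2) 1 * (ν (L * ‖w‖) / ν L) := by gcongr
      _ = _ := by ring

end IsUnimodalLevy

theorem ψ_inv_smul (d : ℕ) (ν : ℝ → ℝ) {L : ℝ} (hL : 0 < L) (ξ : EuclideanSpace ℝ (Fin d)) :
    ψ d ν (L⁻¹ • ξ) =
      L ^ d * ∫ w : EuclideanSpace ℝ (Fin d), (1 - Real.cos ⟪ξ, w⟫) * ν (L * ‖w‖) := by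
  have hLd : 0 < L ^ d := pow_pos hL d
  have h := Measure.integral_comp_smul (volume : Measure (EuclideanSpace ℝ (Fin d)))
    (fun z => (1 - Real.cos ⟪L⁻¹ • ξ, z⟫) * ν ‖z‖) L
  rw [finrank_euclideanSpace_fin, abs_of_pos (inv_pos.mpr hLd), smul_eq_mul] at h
  simp only [norm_smul, Real.norm_of_nonneg hL.le, real_inner_smul_left, real_inner_smul_right,
    mul_inv_cancel_left₀ hL.ne'] at h
  rw [h, mul_inv_cancel_left₀ hLd.ne', ψ]
  simp only [real_inner_smul_left]

/-- The exponent of the `α`-stable process with Lévy density `|z| ^ (-(d + α))` is a multiple of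
`|ξ| ^ α`. -/
theorem ψ_rpow_eq {d : ℕ} {α : ℝ} (hα : 0 < α) {e : EuclideanSpace ℝ (Fin d)} (he : ‖e‖ = 1)
    (ξ : EuclideanSpace ℝ (Fin d)) :
    ψ d (fun r => r ^ (-((d : ℝ) + α))) ξ =
      ‖ξ‖ ^ α * ψ d (fun r => r ^ (-((d : ℝ) + α))) e := by
  rcases eq_or_ne ξ 0 with rfl | hξ
  · rw [ψ_zero, norm_zero, Real.zero_rpow hα.ne', zero_mul]
  have hn : 0 < ‖ξ‖ := norm_pos_iff.mpr hξ
  have hn' : ‖ξ‖ = ‖(‖ξ‖⁻¹)⁻¹ • e‖ := by rw [norm_smul, he, inv_inv, norm_norm, mul_one]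
  have hi : 0 < ‖ξ‖⁻¹ := inv_pos.mpr hn
  rw [ψ_eq_of_norm_eq d _ hn', ψ_inv_smul d _ hi, ψ, ← integral_const_mul, ← integral_const_mul]
  refine integral_congr_ae (Eventually.of_forall fun w => ?_)
  simp only
  have hc : (‖ξ‖⁻¹) ^ d * (‖ξ‖⁻¹) ^ (-((d : ℝ) + α)) = ‖ξ‖ ^ α := by
    rw [← Real.rpow_natCast, ← Real.rpow_add hi, Real.inv_rpow hn.le, ← Real.rpow_neg hn.le]
    congr 1
    ring
  rw [Real.mul_rpow hi.le (norm_nonneg _), ← hc]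
  ring

namespace IsUnimodalLevy

variable {d : ℕ} {ν : ℝ → ℝ} {α : ℝ}

theorem abs_ψ_sub_le [NeZero d] (hν : IsUnimodalLevy d ν) (hα : α ∈ Set.Ioo (0 : ℝ) 2) {L : ℝ}
    (hL : 1 ≤ L) (ξ : EuclideanSpace ℝ (Fin d)) :
    |ψ d ν (L⁻¹ • ξ) / (L ^ d * ν L) - ψ d (fun r => r ^ (-((d : ℝ) + α))) ξ| ≤
      2 * max (‖ξ‖ ^ 2) 1 * profileDist d ν α L := by
  have hL0 : 0 < L := one_pos.trans_le hL
  have hLd : 0 < L ^ d := pow_pos hL0 d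
  have hνL := hν.pos L hL0
  have hst : IsUnimodalLevy d fun r => r ^ (-((d : ℝ) + α)) :=
    isUnimodalLevy_rpow (by linarith [hα.1]) (by linarith [hα.2])
  have hint : Integrable (fun w : EuclideanSpace ℝ (Fin d) =>
      (1 - Real.cos ⟪ξ, w⟫) * ν (L * ‖w‖)) := by
    refine ((hν.integrable_comp_mul hL).const_mul (2 * max (‖ξ‖ ^ 2) 1)).mono'
      (AEStronglyMeasurable.mul (Continuous.aestronglyMeasurable (by fun_prop))
        (hν.aestronglyMeasurable hL0)) ?_
    filter_upwards [ae_ne_zero] with w hw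
    have hp := hν.pos (L * ‖w‖) (mul_pos hL0 (norm_pos_iff.mpr hw))
    rw [Real.norm_of_nonneg (mul_nonneg (one_sub_cos_nonneg _) hp.le), ← mul_assoc]
    exact mul_le_mul_of_nonneg_right (one_sub_cos_inner_le ξ w) hp.le
  rw [ψ_inv_smul d ν hL0, mul_div_mul_left _ _ hLd.ne', ← integral_div, ψ,
    ← integral_sub (hint.div_const _) (hst.integrable_one_sub_cos ξ), profileDist,
    ← integral_const_mul, ← Real.norm_eq_abs]
  refine norm_integral_le_of_norm_le ((hν.integrable_profile hα hL).const_mul _)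
    (Eventually.of_forall fun w => ?_)
  rw [mul_div_assoc, ← mul_sub, norm_mul, Real.norm_of_nonneg (one_sub_cos_nonneg _),
    Real.norm_eq_abs, ← mul_assoc]
  exact mul_le_mul_of_nonneg_right (one_sub_cos_inner_le ξ w) (abs_nonneg _)

theorem tendsto_ψ_div [NeZero d] (hν : IsUnimodalLevy d ν) (hα : α ∈ Set.Ioo (0 : ℝ) 2)
    (hA2 : ∀ lam : ℝ, 0 < lam →
      Tendsto (fun r : ℝ => ν (lam * r) / ν r) atTop (nhds (lam ^ (-(d : ℝ) - α))))
    (ξ : EuclideanSpace ℝ (Fin d)) :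
    Tendsto (fun L : ℝ => ψ d ν (L⁻¹ • ξ) / (L ^ d * ν L)) atTop
      (nhds (ψ d (fun r => r ^ (-((d : ℝ) + α))) ξ)) := by
  have h := (hν.tendsto_profileDist hα hA2).const_mul (2 * max (‖ξ‖ ^ 2) 1)
  rw [mul_zero] at h
  refine tendsto_iff_norm_sub_tendsto_zero.mpr (squeeze_zero' ?_ ?_ h)
  · exact Eventually.of_forall fun _ => norm_nonneg _
  · filter_upwards [eventually_ge_atTop 1] with L hL
    exact hν.abs_ψ_sub_le hα hL ξ

theorem tendsto_ψstar_div [NeZero d] (hν : IsUnimodalLevy d ν) (hα : α ∈ Set.Ioo (0 : ℝ) 2)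
    (hA2 : ∀ lam : ℝ, 0 < lam →
      Tendsto (fun r : ℝ => ν (lam * r) / ν r) atTop (nhds (lam ^ (-(d : ℝ) - α))))
    {e : EuclideanSpace ℝ (Fin d)} (he : ‖e‖ = 1) :
    Tendsto (fun L : ℝ => ψstar d ν L⁻¹ / (L ^ d * ν L)) atTop
      (nhds (ψ d (fun r => r ^ (-((d : ℝ) + α))) e)) := by
  have hst : IsUnimodalLevy d fun r => r ^ (-((d : ℝ) + α)) :=
    isUnimodalLevy_rpow (by linarith [hα.1]) (by linarith [hα.2])
  set σ := ψ d (fun r => r ^ (-((d : ℝ) + α))) e with hσ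
  have hσ0 : 0 ≤ σ := hst.ψ_nonneg e
  have h := ((hν.tendsto_profileDist hα hA2).const_mul 2).const_add σ
  rw [mul_zero, add_zero] at h
  refine tendsto_of_tendsto_of_tendsto_of_le_of_le' (hν.tendsto_ψ_div hα hA2 e) h ?_ ?_
  · filter_upwards [eventually_gt_atTop 0] with L hL
    have := hν.pos L hL
    have := hν.ψ_le_ψstar (z := L⁻¹ • e) (r := L⁻¹)
      (by rw [norm_smul, he, mul_one, Real.norm_of_nonneg (by positivity)])
    gcongr
  · filter_upwards [eventually_ge_atTop 1] with L hL
    have hL0 : 0 < L := one_pos.trans_le hL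
    have hg : 0 < L ^ d * ν L := mul_pos (pow_pos hL0 d) (hν.pos L hL0)
    rw [div_le_iff₀ hg]
    refine ψstar_le (by positivity) fun z hz => ?_
    have hz' : ‖L • z‖ ≤ 1 := by
      rw [norm_smul, Real.norm_of_nonneg hL0.le]
      calc L * ‖z‖ ≤ L * L⁻¹ := by gcongr
        _ = 1 := mul_inv_cancel₀ hL0.ne'
    have h1 := hν.abs_ψ_sub_le hα hL (L • z)
    rw [inv_smul_smul₀ hL0.ne', ψ_rpow_eq hα.1 he, ← hσ,
      max_eq_right (pow_le_one₀ (norm_nonneg _) hz'), mul_one] at h1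
    have h2 : ‖L • z‖ ^ α * σ ≤ σ :=
      mul_le_of_le_one_left hσ0 (Real.rpow_le_one (norm_nonneg _) hz' hα.1.le)
    rw [← div_le_iff₀ hg]
    linarith [(abs_le.mp h1).2]

theorem tendsto_ψ_div_ψstar [NeZero d] (hν : IsUnimodalLevy d ν) (hα : α ∈ Set.Ioo (0 : ℝ) 2)
    (hA2 : ∀ lam : ℝ, 0 < lam →
      Tendsto (fun r : ℝ => ν (lam * r) / ν r) atTop (nhds (lam ^ (-(d : ℝ) - α))))
    (ξ : EuclideanSpace ℝ (Fin d)) :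
    Tendsto (fun L : ℝ => ψ d ν (L⁻¹ • ξ) / ψstar d ν L⁻¹) atTop (nhds (‖ξ‖ ^ α)) := by
  obtain ⟨e, he⟩ := exists_norm_eq_one d
  have hst : IsUnimodalLevy d fun r => r ^ (-((d : ℝ) + α)) :=
    isUnimodalLevy_rpow (by linarith [hα.1]) (by linarith [hα.2])
  have hσ := hst.ψ_pos (norm_pos_iff.mp (he ▸ one_pos))
  have h := (hν.tendsto_ψ_div hα hA2 ξ).div (hν.tendsto_ψstar_div hα hA2 he) hσ.ne'
  rw [ψ_rpow_eq hα.1 he, mul_div_cancel_right₀ _ hσ.ne'] at h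
  refine h.congr' ?_
  filter_upwards [eventually_gt_atTop 0] with L hL
  exact div_div_div_cancel_right₀ (mul_pos (pow_pos hL d) (hν.pos L hL)).ne' _ _

/-- Lower power bound for the rescaled exponents in the low-frequency region, and decay of
`ψ*` at the origin. -/
theorem exists_rpow_bounds [NeZero d] (hν : IsUnimodalLevy d ν) (hα : α ∈ Set.Ioo (0 : ℝ) 2)
    (hA2 : ∀ lam : ℝ, 0 < lam →
      Tendsto (fun r : ℝ => ν (lam * r) / ν r) atTop (nhds (lam ^ (-(d : ℝ) - α)))) :
    ∃ β c C M : ℝ, 0 < β ∧ 0 < c ∧ 0 < C ∧ 1 ≤ M ∧ ∀ L : ℝ, M ≤ L →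
      ψstar d ν L⁻¹ ≤ C * L ^ (-β) ∧
      ∀ ξ : EuclideanSpace ℝ (Fin d), M * ‖ξ‖ ≤ L →
        c * ‖ξ‖ ^ β - c ≤ ψ d ν (L⁻¹ • ξ) / ψstar d ν L⁻¹ := by
  obtain ⟨γ₁, γ₂, M₀, K, h₁, -, -, -, hP⟩ := hν.exists_potterBounds hα hA2
  obtain ⟨e, he⟩ := exists_norm_eq_one d
  have hst : IsUnimodalLevy d fun r => r ^ (-((d : ℝ) + α)) :=
    isUnimodalLevy_rpow (by linarith [hα.1]) (by linarith [hα.2])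
  have hσ := hst.ψ_pos (norm_pos_iff.mp (he ▸ one_pos))
  have hdist := (hν.tendsto_profileDist hα hA2).eventually_lt_const
    (show 0 < ψ d (fun r => r ^ (-((d : ℝ) + α))) e / 4 by positivity)
  have hstar := (hν.tendsto_ψstar_div hα hA2 he).eventually_lt_const
    (show _ < 2 * ψ d (fun r => r ^ (-((d : ℝ) + α))) e by linarith)
  set σ := ψ d (fun r => r ^ (-((d : ℝ) + α))) e with hσdef
  obtain ⟨M₁, hM₁⟩ := eventually_atTop.mp (hdist.and hstar)
  have hM₀0 : 0 < M₀ := one_pos.trans_le hP.one_le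
  have hK := hP.const_pos
  have hνM₀ := hν.pos M₀ hM₀0
  have hM : 1 ≤ max M₀ M₁ := hP.one_le.trans (le_max_left _ _)
  have hpow (x : ℝ) (hx : 0 < x) : x ^ d * x ^ (-γ₁) = x ^ (-(γ₁ - d)) := by
    rw [← Real.rpow_natCast, ← Real.rpow_add hx]
    congr 1
    ring
  refine ⟨γ₁ - d, (4 * K)⁻¹, 2 * σ * (K * M₀ ^ γ₁ * ν M₀), max M₀ M₁, by linarith, by positivity,
    by positivity, hM, fun L hL => ?_⟩
  have hL1 : 1 ≤ L := hM.trans hL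
  have hL0 : 0 < L := one_pos.trans_le hL1
  have hg : 0 < L ^ d * ν L := mul_pos (pow_pos hL0 d) (hν.pos L hL0)
  have hstarL : ψstar d ν L⁻¹ ≤ 2 * σ * (L ^ d * ν L) :=
    (div_le_iff₀ hg).mp (hM₁ L ((le_max_right _ _).trans hL)).2.le
  have hstar0 : 0 < ψstar d ν L⁻¹ := hν.ψstar_pos (by positivity)
  constructor
  · calc ψstar d ν L⁻¹ ≤ 2 * σ * (L ^ d * ν L) := hstarL
      _ ≤ 2 * σ * (L ^ d * (K * M₀ ^ γ₁ * ν M₀ * L ^ (-γ₁))) := by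
        have := hP.le ((le_max_left _ _).trans hL)
        gcongr
      _ = _ := by rw [← hpow L hL0]; ring
  · intro ξ hξ
    rcases le_total ‖ξ‖ 1 with hξ1 | hξ1
    · have h0 : 0 ≤ ψ d ν (L⁻¹ • ξ) / ψstar d ν L⁻¹ := div_nonneg (hν.ψ_nonneg _) hstar0.le
      have h2 : (4 * K)⁻¹ * ‖ξ‖ ^ (γ₁ - d) ≤ (4 * K)⁻¹ * 1 := by
        have := Real.rpow_le_one (norm_nonneg ξ) hξ1 (show 0 ≤ γ₁ - d by linarith)
        gcongr
      linarith
    · have hn : 0 < ‖ξ‖ := one_pos.trans_le hξ1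
      set l := L / ‖ξ‖ with hl
      have hlM : max M₀ M₁ ≤ l := (le_div_iff₀ hn).mpr hξ
      have hl1 : 1 ≤ l := hM.trans hlM
      have hl0 : 0 < l := one_pos.trans_le hl1
      have hLl : L = ‖ξ‖ * l := (mul_div_cancel₀ L hn.ne').symm
      have hνl := hν.pos l hl0
      have hunit : ‖‖ξ‖⁻¹ • ξ‖ = 1 := by
        rw [norm_smul, norm_inv, norm_norm, inv_mul_cancel₀ hn.ne']
      have harg : L⁻¹ • ξ = l⁻¹ • (‖ξ‖⁻¹ • ξ) := by
        rw [smul_smul, ← mul_inv, hLl, mul_comm l]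
      have hlow : σ / 2 * (l ^ d * ν l) ≤ ψ d ν (L⁻¹ • ξ) := by
        have h := hν.abs_ψ_sub_le hα hl1 (‖ξ‖⁻¹ • ξ)
        rw [ψ_rpow_eq hα.1 he, ← hσdef, hunit, Real.one_rpow, one_mul, one_pow, max_self, mul_one,
          ← harg] at h
        have h' := (hM₁ l ((le_max_right _ _).trans hlM)).1
        rw [← le_div_iff₀ (by positivity)]
        linarith [(abs_le.mp h).1]
      have hup : ν L ≤ K * ‖ξ‖ ^ (-γ₁) * ν l := by
        have := hP.upper l ((le_max_left _ _).trans hlM) ‖ξ‖ hξ1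
        rwa [← hLl] at this
      have hup' : ψstar d ν L⁻¹ ≤ 2 * σ * (l ^ d * (K * ‖ξ‖ ^ (-(γ₁ - d)) * ν l)) := by
        calc ψstar d ν L⁻¹ ≤ 2 * σ * (L ^ d * ν L) := hstarL
          _ ≤ 2 * σ * (L ^ d * (K * ‖ξ‖ ^ (-γ₁) * ν l)) := by gcongr
          _ = _ := by rw [← hpow _ hn, hLl, mul_pow]; ring
      have hmain : (4 * K)⁻¹ * ‖ξ‖ ^ (γ₁ - d) ≤ ψ d ν (L⁻¹ • ξ) / ψstar d ν L⁻¹ := by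
        rw [le_div_iff₀ hstar0]
        calc (4 * K)⁻¹ * ‖ξ‖ ^ (γ₁ - d) * ψstar d ν L⁻¹
            ≤ (4 * K)⁻¹ * ‖ξ‖ ^ (γ₁ - d) *
              (2 * σ * (l ^ d * (K * ‖ξ‖ ^ (-(γ₁ - d)) * ν l))) := by gcongr
          _ = σ / 2 * (l ^ d * ν l) := by
            rw [Real.rpow_neg hn.le]
            have : ‖ξ‖ ^ (γ₁ - d) ≠ 0 := (Real.rpow_pos_of_pos hn _).ne'
            field_simp
            norm_num
          _ ≤ _ := hlow
      have : 0 < (4 * K)⁻¹ := by positivity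
      linarith

end IsUnimodalLevy

theorem abs_exp_neg_sub_exp_neg_le {x y : ℝ} (hx : 0 ≤ x) (hy : 0 ≤ y) :
    |Real.exp (-x) - Real.exp (-y)| ≤ |x - y| := by
  wlog h : x ≤ y generalizing x y
  · rw [abs_sub_comm, abs_sub_comm x]
    exact this hy hx (le_of_not_ge h)
  have h1 : Real.exp (-y) = Real.exp (-x) * Real.exp (-(y - x)) := by
    rw [← Real.exp_add]; congr 1; ring
  have h2 : 1 - (y - x) ≤ Real.exp (-(y - x)) := by
    linarith [Real.add_one_le_exp (-(y - x))]
  have h3 : Real.exp (-(y - x)) ≤ 1 := Real.exp_le_one_iff.mpr (by linarith)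
  have h4 : Real.exp (-x) ≤ 1 := Real.exp_le_one_iff.mpr (by linarith)
  rw [abs_of_nonneg (by rw [h1]; nlinarith [Real.exp_pos (-x)]),
    abs_of_nonpos (by linarith), h1]
  nlinarith [Real.exp_pos (-x)]

/-- Replacing the exponent `a` by `b` in `e^{-ta}`, uniformly for `t ∈ [ε, T]`. -/
theorem abs_exp_neg_mul_sub_le_min {ε T t a b : ℝ} (hε : 0 ≤ ε) (hεt : ε ≤ t) (htT : t ≤ T)
    (ha : 0 ≤ a) (hb : 0 ≤ b) :
    |Real.exp (-(t * a)) - Real.exp (-(t * b))| ≤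
      min (T * |a - b|) (Real.exp (-(ε * b)) + Real.exp (-(ε * a))) := by
  have ht : 0 ≤ t := hε.trans hεt
  refine le_min ?_ ?_
  · calc |Real.exp (-(t * a)) - Real.exp (-(t * b))| ≤ |t * a - t * b| :=
          abs_exp_neg_sub_exp_neg_le (by positivity) (by positivity)
      _ = t * |a - b| := by rw [← mul_sub, abs_mul, abs_of_nonneg ht]
      _ ≤ T * |a - b| := by gcongr
  · have h1 : Real.exp (-(t * a)) ≤ Real.exp (-(ε * a)) := by gcongr
    have h2 : Real.exp (-(t * b)) ≤ Real.exp (-(ε * b)) := by gcongr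
    rw [abs_le]
    constructor <;> linarith [Real.exp_pos (-(t * a)), Real.exp_pos (-(t * b))]

namespace IsUnimodalLevy

variable {d : ℕ} [NeZero d] {ν : ℝ → ℝ}

theorem tendsto_integral_min_abs_sub (hν : IsUnimodalLevy d ν) {α : ℝ}
    (hα : α ∈ Set.Ioo (0 : ℝ) 2)
    (hA2 : ∀ lam : ℝ, 0 < lam →
      Tendsto (fun r : ℝ => ν (lam * r) / ν r) atTop (nhds (lam ^ (-(d : ℝ) - α))))
    {T : ℝ} (hT : 0 ≤ T) {g : EuclideanSpace ℝ (Fin d) → ℝ} (hg : Integrable g)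
    (hg0 : ∀ ξ, 0 ≤ g ξ) :
    Tendsto (fun L : ℝ => ∫ ξ : EuclideanSpace ℝ (Fin d),
      min (T * |ψ d ν (L⁻¹ • ξ) / ψstar d ν L⁻¹ - ‖ξ‖ ^ α|) (g ξ)) atTop (nhds 0) := by
  have hψ := hν.continuous_ψ
  have hcα : Continuous fun ξ : EuclideanSpace ℝ (Fin d) => ‖ξ‖ ^ α :=
    continuous_norm.rpow_const fun _ => Or.inr hα.1.le
  rw [← integral_zero (EuclideanSpace ℝ (Fin d)) ℝ]
  refine tendsto_integral_filter_of_dominated_convergence g ?_ ?_ hg ?_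
  · refine Eventually.of_forall fun L => ?_
    have hc : Continuous fun ξ : EuclideanSpace ℝ (Fin d) =>
        T * |ψ d ν (L⁻¹ • ξ) / ψstar d ν L⁻¹ - ‖ξ‖ ^ α| := by
      have : Continuous fun ξ : EuclideanSpace ℝ (Fin d) => ψ d ν (L⁻¹ • ξ) :=
        hψ.comp (continuous_const_smul _)
      fun_prop
    exact hc.aestronglyMeasurable.inf hg.aestronglyMeasurable
  · refine Eventually.of_forall fun L => Eventually.of_forall fun ξ => ?_
    rw [Real.norm_of_nonneg (le_min (by positivity) (hg0 ξ))]
    exact min_le_right _ _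
  · refine Eventually.of_forall fun ξ => ?_
    have h := ((((hν.tendsto_ψ_div_ψstar hα hA2 ξ).sub_const (‖ξ‖ ^ α)).abs).const_mul T).min
      (tendsto_const_nhds (x := g ξ))
    simpa [hg0 ξ] using h

/-- The contribution of the frequencies where `ψ` is bounded below by `m` vanishes after
rescaling. -/
theorem tendsto_integral_high_frequency (hν : IsUnimodalLevy d ν) {ε t₀ m β C M : ℝ}
    (hε : 0 < ε) (hm : 0 < m) (hβ : 0 < β) (hC : 0 < C)
    (hstar : ∀ L, M ≤ L → ψstar d ν L⁻¹ ≤ C * L ^ (-β)) :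
    Tendsto (fun L : ℝ => ∫ ξ : EuclideanSpace ℝ (Fin d),
      Real.exp (-((ε / ψstar d ν L⁻¹ - t₀) * m)) * Real.exp (-(t₀ * ψ d ν (L⁻¹ • ξ))))
      atTop (nhds 0) := by
  set I := ∫ ξ : EuclideanSpace ℝ (Fin d), Real.exp (-(t₀ * ψ d ν ξ)) with hI
  have hI0 : 0 ≤ I := integral_nonneg fun _ => (Real.exp_pos _).le
  have hlim : Tendsto (fun L : ℝ => Real.exp (t₀ * m) * I *
      ((L ^ β) ^ ((d : ℝ) / β) * Real.exp (-(ε * m / C) * L ^ β))) atTop (nhds 0) := by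
    have h := (tendsto_rpow_mul_exp_neg_mul_atTop_nhds_zero ((d : ℝ) / β) (ε * m / C)
      (by positivity)).comp (tendsto_rpow_atTop hβ)
    simpa [Function.comp_def] using h.const_mul (Real.exp (t₀ * m) * I)
  refine squeeze_zero' (Eventually.of_forall fun L => integral_nonneg fun _ => by positivity) ?_
    hlim
  filter_upwards [eventually_gt_atTop 0, eventually_ge_atTop M] with L hL hML
  have hstar0 : 0 < ψstar d ν L⁻¹ := hν.ψstar_pos (inv_pos.mpr hL)
  rw [integral_const_mul,
    Measure.integral_comp_smul volume (fun ξ => Real.exp (-(t₀ * ψ d ν ξ))) L⁻¹,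
    finrank_euclideanSpace_fin, ← hI, smul_eq_mul, inv_pow, inv_inv, abs_of_pos (by positivity)]
  have hLd : (L ^ β) ^ ((d : ℝ) / β) = L ^ d := by
    rw [← Real.rpow_mul hL.le, mul_div_cancel₀ _ hβ.ne', Real.rpow_natCast]
  have hexp : Real.exp (-((ε / ψstar d ν L⁻¹ - t₀) * m)) ≤
      Real.exp (t₀ * m) * Real.exp (-(ε * m / C) * L ^ β) := by
    rw [← Real.exp_add]
    gcongr
    have h1 : ε / (C * L ^ (-β)) ≤ ε / ψstar d ν L⁻¹ := by
      gcongr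
      exact hstar L hML
    have h2 : ε / (C * L ^ (-β)) = ε / C * L ^ β := by
      rw [Real.rpow_neg hL.le]
      have : L ^ β ≠ 0 := (Real.rpow_pos_of_pos hL _).ne'
      field_simp
    rw [h2] at h1
    have h3 := mul_le_mul_of_nonneg_right h1 hm.le
    have h4 : ε / C * L ^ β * m = ε * m / C * L ^ β := by ring
    linarith
  rw [hLd]
  calc _ ≤ Real.exp (t₀ * m) * Real.exp (-(ε * m / C) * L ^ β) * (L ^ d * I) := by gcongr
    _ = _ := by ring

/-- `e^{-tψ(ξ/L)/ψ*(1/L)}` converges to `e^{-t|ξ|^α}` in `L¹`, uniformly for `t ∈ [ε, T]`. -/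
theorem eventually_integral_abs_exp_sub_le (hν : IsUnimodalLevy d ν) {α : ℝ}
    (hα : α ∈ Set.Ioo (0 : ℝ) 2)
    (hA2 : ∀ lam : ℝ, 0 < lam →
      Tendsto (fun r : ℝ => ν (lam * r) / ν r) atTop (nhds (lam ^ (-(d : ℝ) - α))))
    {t₀ : ℝ} (ht₀ : 0 < t₀)
    (hA3 : Integrable fun ξ : EuclideanSpace ℝ (Fin d) => Real.exp (-(t₀ * ψ d ν ξ)))
    {ε T η : ℝ} (hε : 0 < ε) (hεT : ε ≤ T) (hη : 0 < η) :
    ∀ᶠ L : ℝ in atTop, ∀ t, ε ≤ t → t ≤ T →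
      Integrable (fun ξ : EuclideanSpace ℝ (Fin d) =>
        Real.exp (-(t * (ψ d ν (L⁻¹ • ξ) / ψstar d ν L⁻¹)))) ∧
      ∫ ξ : EuclideanSpace ℝ (Fin d), |Real.exp (-(t * (ψ d ν (L⁻¹ • ξ) / ψstar d ν L⁻¹))) -
        Real.exp (-(t * ‖ξ‖ ^ α))| ≤ η := by
  obtain ⟨β, c, C, M, hβ, hc, hC, hM, hbounds⟩ := hν.exists_rpow_bounds hα hA2
  obtain ⟨m, hm, hmψ⟩ := hν.exists_pos_le_ψ (δ := M⁻¹) (by positivity)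
  set g : EuclideanSpace ℝ (Fin d) → ℝ := fun ξ =>
    Real.exp (-(ε * ‖ξ‖ ^ α)) + Real.exp (ε * c) * Real.exp (-(ε * c * ‖ξ‖ ^ β)) with hg
  have hgint : Integrable g := (integrable_exp_neg_mul_norm_rpow hε hα.1).add
    ((integrable_exp_neg_mul_norm_rpow (by positivity) hβ).const_mul _)
  have hg0 : ∀ ξ, 0 ≤ g ξ := fun ξ => by positivity
  have hT : 0 ≤ T := hε.le.trans hεT
  have hψ := hν.continuous_ψ
  have hcα : Continuous fun ξ : EuclideanSpace ℝ (Fin d) => ‖ξ‖ ^ α :=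
    continuous_norm.rpow_const fun _ => Or.inr hα.1.le
  have hlow := (hν.tendsto_integral_min_abs_sub hα hA2 hT hgint hg0).eventually_lt_const
    (half_pos hη)
  have hhigh := (hν.tendsto_integral_high_frequency (t₀ := t₀) hε hm hβ hC
    fun L hL => (hbounds L hL).1).eventually_lt_const (half_pos hη)
  have hsmall : ∀ᶠ L : ℝ in atTop, C * L ^ (-β) < ε / t₀ := by
    have h := (tendsto_rpow_neg_atTop hβ).const_mul C
    rw [mul_zero] at h
    exact h.eventually_lt_const (by positivity)
  filter_upwards [hlow, hhigh, hsmall, eventually_ge_atTop M] with L hlowL hhighL hsmallL hML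
  intro t hεt htT
  have hL : 0 < L := by linarith
  have hstar0 : 0 < ψstar d ν L⁻¹ := hν.ψstar_pos (inv_pos.mpr hL)
  have hstar_le : t₀ ≤ ε / ψstar d ν L⁻¹ := by
    have h := ((hbounds L hML).1.trans_lt hsmallL).le
    rw [le_div_iff₀ ht₀] at h
    rw [le_div_iff₀ hstar0]
    linarith
  have hcL : Continuous fun ξ : EuclideanSpace ℝ (Fin d) => ψ d ν (L⁻¹ • ξ) :=
    hψ.comp (continuous_const_smul _)
  have hdom : Integrable fun ξ : EuclideanSpace ℝ (Fin d) =>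
      Real.exp (-(t₀ * ψ d ν (L⁻¹ • ξ))) := hA3.comp_smul (inv_ne_zero hL.ne')
  have hint : Integrable (fun ξ : EuclideanSpace ℝ (Fin d) =>
      Real.exp (-(t * (ψ d ν (L⁻¹ • ξ) / ψstar d ν L⁻¹)))) := by
    refine hdom.mono' (Continuous.aestronglyMeasurable (by fun_prop))
      (Eventually.of_forall fun ξ => ?_)
    rw [Real.norm_of_nonneg (Real.exp_pos _).le]
    have h0 := hν.ψ_nonneg (L⁻¹ • ξ)
    have h1 : t₀ ≤ t / ψstar d ν L⁻¹ := hstar_le.trans (by gcongr)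
    rw [mul_div_left_comm, mul_comm (ψ d ν (L⁻¹ • ξ))]
    gcongr
  refine ⟨hint, ?_⟩
  have hpt : ∀ ξ : EuclideanSpace ℝ (Fin d),
      |Real.exp (-(t * (ψ d ν (L⁻¹ • ξ) / ψstar d ν L⁻¹))) - Real.exp (-(t * ‖ξ‖ ^ α))| ≤
        min (T * |ψ d ν (L⁻¹ • ξ) / ψstar d ν L⁻¹ - ‖ξ‖ ^ α|) (g ξ) +
        Real.exp (-((ε / ψstar d ν L⁻¹ - t₀) * m)) * Real.exp (-(t₀ * ψ d ν (L⁻¹ • ξ))) := by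
    intro ξ
    have h0 := hν.ψ_nonneg (L⁻¹ • ξ)
    have hb : 0 ≤ ‖ξ‖ ^ α := by positivity
    set a := ψ d ν (L⁻¹ • ξ) / ψstar d ν L⁻¹ with ha
    have ha0 : 0 ≤ a := by positivity
    have hmin := abs_exp_neg_mul_sub_le_min hε.le hεt htT ha0 hb
    rcases le_or_gt (M * ‖ξ‖) L with hξ | hξ
    · have hacase : Real.exp (-(ε * a)) ≤
          Real.exp (ε * c) * Real.exp (-(ε * c * ‖ξ‖ ^ β)) := by
        rw [← Real.exp_add]
        gcongr
        nlinarith [(hbounds L hML).2 ξ hξ]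
      refine (hmin.trans (min_le_min_left _ ?_)).trans (le_add_of_nonneg_right (by positivity))
      simp only [hg]
      linarith
    · have hmξ : m ≤ ψ d ν (L⁻¹ • ξ) := by
        refine hmψ _ ?_
        rw [norm_smul, Real.norm_of_nonneg (inv_nonneg.mpr hL.le),
          inv_le_iff_one_le_mul₀ (by linarith), mul_assoc, ← div_eq_inv_mul, le_div_iff₀ hL]
        linarith
      have hacase : Real.exp (-(ε * a)) ≤ Real.exp (-((ε / ψstar d ν L⁻¹ - t₀) * m)) *
          Real.exp (-(t₀ * ψ d ν (L⁻¹ • ξ))) := by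
        rw [← Real.exp_add]
        gcongr
        have h1 : ε * a = ε / ψstar d ν L⁻¹ * ψ d ν (L⁻¹ • ξ) := by rw [ha]; ring
        rw [h1]
        nlinarith [mul_le_mul_of_nonneg_left hmξ (sub_nonneg.mpr hstar_le)]
      rw [← min_add_add_right]
      refine hmin.trans (min_le_min (le_add_of_nonneg_right (by positivity)) ?_)
      have : Real.exp (-(ε * ‖ξ‖ ^ α)) ≤ g ξ := le_add_of_nonneg_right (by positivity)
      linarith
  have hminint : Integrable fun ξ : EuclideanSpace ℝ (Fin d) =>
      min (T * |ψ d ν (L⁻¹ • ξ) / ψstar d ν L⁻¹ - ‖ξ‖ ^ α|) (g ξ) := by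
    refine hgint.mono' ?_ (Eventually.of_forall fun ξ => ?_)
    · exact (Continuous.aestronglyMeasurable (by fun_prop)).inf hgint.aestronglyMeasurable
    · rw [Real.norm_of_nonneg (le_min (by positivity) (hg0 ξ))]
      exact min_le_right _ _
  calc _ ≤ ∫ ξ : EuclideanSpace ℝ (Fin d),
        (min (T * |ψ d ν (L⁻¹ • ξ) / ψstar d ν L⁻¹ - ‖ξ‖ ^ α|) (g ξ) +
        Real.exp (-((ε / ψstar d ν L⁻¹ - t₀) * m)) * Real.exp (-(t₀ * ψ d ν (L⁻¹ • ξ)))) :=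
        integral_mono_of_nonneg (Eventually.of_forall fun _ => abs_nonneg _)
          (hminint.add (hdom.const_mul _)) (Eventually.of_forall hpt)
    _ ≤ η := by
      rw [integral_add hminint (hdom.const_mul _)]
      linarith

end IsUnimodalLevy

theorem statement13
    (d : ℕ) (hd : 1 ≤ d) (ν : ℝ → ℝ)
    (hν_pos : ∀ r : ℝ, 0 < r → 0 < ν r)
    (hν_mono : ∀ r₁ r₂ : ℝ, 0 < r₁ → r₁ ≤ r₂ → ν r₂ ≤ ν r₁)
    (hint : Integrable (fun z : EuclideanSpace ℝ (Fin d) => min (‖z‖ ^ 2) 1 * ν ‖z‖))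
    (hninf : ¬ Integrable (fun z : EuclideanSpace ℝ (Fin d) => ν ‖z‖))
    (α : ℝ) (hα : α ∈ Set.Ioo (0:ℝ) 2)
    (hA2 : ∀ lam : ℝ, 0 < lam →
      Tendsto (fun r : ℝ => ν (lam * r) / ν r) atTop (nhds (lam ^ (-(d:ℝ) - α))))
    (t₀ : ℝ) (ht₀ : 0 < t₀)
    (hA3 : Integrable (fun ξ : EuclideanSpace ℝ (Fin d) => Real.exp (-(t₀ * ψ d ν ξ))))
    (hnorm : ∀ ξ : EuclideanSpace ℝ (Fin d), ‖ξ‖ = 1 → ψ d ν ξ = 1)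
:
    ∀ ε T R : ℝ, 0 < ε → ε ≤ T → 0 < R → ∀ η : ℝ, 0 < η →
      ∃ s₀ : ℝ, ∀ s : ℝ, s₀ ≤ s →
        ∀ t : ℝ, ∀ x : EuclideanSpace ℝ (Fin d),
          ε ≤ t → t ≤ T → ‖x‖ ≤ R →
            |pts d ν s t x - ptα d α t x| ≤ η := by
  have : NeZero d := ⟨by omega⟩
  have hν : IsUnimodalLevy d ν := ⟨hν_pos, hν_mono, hint⟩
  intro ε T R hε hεT _ η hη
  have hpi : 0 < (2 * Real.pi) ^ d := by positivity
  have hL := hν.tendsto_inv_ψinv.eventually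
    (hν.eventually_integral_abs_exp_sub_le hα hA2 ht₀ hA3 hε hεT (mul_pos hpi hη))
  obtain ⟨s₀, hs₀⟩ := eventually_atTop.mp (hL.and (hν.eventually_ψinv_spec one_pos))
  refine ⟨s₀, fun s hs t x hεt htT _ => ?_⟩
  obtain ⟨hclose, -, -, hstar⟩ := hs₀ s hs
  obtain ⟨hints, hdiff⟩ := hclose t hεt htT
  have hψs : ∀ ξ, ψ d ν ((ψinv d ν (1 / s))⁻¹⁻¹ • ξ) / ψstar d ν (ψinv d ν (1 / s))⁻¹⁻¹ =
      ψs d ν s ξ := fun ξ => by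
    rw [inv_inv, hstar, ψs, div_div_eq_mul_div, div_one, mul_comm]
  simp only [hψs] at hints hdiff
  have hintα : Integrable fun ξ : EuclideanSpace ℝ (Fin d) => Real.exp (-(t * ‖ξ‖ ^ α)) :=
    integrable_exp_neg_mul_norm_rpow (hε.trans_le hεt) hα.1
  have hcos : ∀ f : EuclideanSpace ℝ (Fin d) → ℝ, Integrable f →
      Integrable fun ξ => Real.cos ⟪ξ, x⟫ * f ξ := fun f hf =>
    hf.bdd_mul (c := 1) (Continuous.aestronglyMeasurable (by fun_prop))
      (Eventually.of_forall fun ξ => Real.abs_cos_le_one _)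
  rw [pts, ptα, ← mul_sub, ← integral_sub (hcos _ hints) (hcos _ hintα), abs_mul,
    abs_of_pos (inv_pos.mpr hpi), inv_mul_le_iff₀ hpi]
  refine (abs_integral_le_integral_abs.trans ?_).trans hdiff
  refine integral_mono_of_nonneg (Eventually.of_forall fun _ => abs_nonneg _)
    (hints.sub hintα).abs (Eventually.of_forall fun ξ => ?_)
  beta_reduce
  rw [← mul_sub, abs_mul]
  exact mul_le_of_le_one_left (abs_nonneg _) (Real.abs_cos_le_one _)

end
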